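/- arXiv:1606.02549 — 2 statements merged into one kernel-verified Lean document; each statement's English description precedes it below -/
import Mathlib

section
/- High frequency resolvent estimate on ℝ^d with damping at infinity (a priori form). Let d ≥ 1 and c₀ > 0. Let α : ℝ^d → ℝ be a bounded measurable function with α(x) ≥ 0 for all x and such that α(x) ≥ c₀ for all x outside some bounded subset of ℝ^d. Then there exist τ₀ > 0 and c ≥ 0 such that for every real τ with |τ| ≥ τ₀ and every u ∈ C_c^∞(ℝ^d, ℂ), one has ‖u‖_{L²(ℝ^d)} ≤ (c/|τ|) ‖−Δu − iταu − τ²u‖_{L²(ℝ^d)}. -/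
open MeasureTheory
open scoped ContDiff

noncomputable section

/-- `ℝ^d`, as a Euclidean space. -/
abbrev Ed (d : ℕ) := EuclideanSpace ℝ (Fin d)

/-- Partial derivative of `f : ℝ^d → ℂ` in the `j`-th coordinate direction. -/
noncomputable def partialDeriv {d : ℕ} (f : Ed d → ℂ) (j : Fin d) (x : Ed d) : ℂ :=
  fderiv ℝ f x (EuclideanSpace.single j 1)

/-- Laplacian of `f : ℝ^d → ℂ`: `Δf = ∑ⱼ ∂²f/∂xⱼ²`. -/
noncomputable def laplacian' {d : ℕ} (f : Ed d → ℂ) (x : Ed d) : ℂ :=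
  ∑ j, partialDeriv (partialDeriv f j) j x

/-- The `L²` norm `(∫ ‖f x‖²)^{1/2}` of a function on `ℝ^d`. -/
noncomputable def l2Norm {d : ℕ} (f : Ed d → ℂ) : ℝ :=
  Real.sqrt (∫ x, ‖f x‖ ^ 2)


lemma young_aux (k c x y z w : ℝ) (hk : 0 < k) (hc : |c| ≤ 1) :
    c * (x * y + z * w) ≤ k * (x ^ 2 + z ^ 2) + 1 / (4 * k) * (y ^ 2 + w ^ 2) := by
  have hc2 : c ^ 2 ≤ 1 := by rw [← sq_abs]; have := abs_nonneg c; nlinarith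
  have e : k * (x ^ 2 + z ^ 2) + 1 / (4 * k) * (y ^ 2 + w ^ 2) - c * (x * y + z * w)
     = 1 / (4 * k) * ((2 * k * x - c * y) ^ 2 + (2 * k * z - c * w) ^ 2 + (1 - c ^ 2) * (y ^ 2 + w ^ 2)) := by
    field_simp
    ring
  have : 0 ≤ 1 / (4 * k) * ((2 * k * x - c * y) ^ 2 + (2 * k * z - c * w) ^ 2 + (1 - c ^ 2) * (y ^ 2 + w ^ 2)) := by
    have : 0 ≤ 1 - c ^ 2 := by linarith
    positivity
  linarith

/-- damping term -/
lemma pt_damp (η τ al a b L N : ℝ) (hη : 0 < η) :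
    τ ^ 2 * al * (a ^ 2 + b ^ 2) ≤ η * (τ ^ 2 * (a ^ 2 + b ^ 2))
      + 1 / (4 * η) * ((-L + τ * al * b - τ ^ 2 * a) ^ 2 + (-N - τ * al * a - τ ^ 2 * b) ^ 2)
      - τ * (a * N - b * L) := by
  have := young_aux η 1 (-(τ * a)) (-N - τ * al * a - τ ^ 2 * b) (τ * b) (-L + τ * al * b - τ ^ 2 * a) hη (by simp)
  nlinarith [this]

/-- one-direction Morawetz bound; `S` is `Δ`-type part -/
lemma pt_mor (δ η τ al M g g' ε a b A B L N P : ℝ) (hδ : 0 < δ) (hη : 0 < η) (hτ : 1 ≤ |τ|)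
    (hal : 0 ≤ al) (hM : al ≤ M) (hg : |g| ≤ 1) (hg' : |g'| ≤ 1) (hε : |ε| ≤ 1) :
    g' * (A ^ 2 + B ^ 2) ≤
      ((g * (A * L + B * N) + g' * (A ^ 2 + B ^ 2) - 1 / 2 * g' * P)
        + 1 / 2 * (g' * (P + a * L + b * N) - ε ^ 2 * g * (a * A + b * B))
        + τ ^ 2 * (1 / 2 * g' * (a ^ 2 + b ^ 2) + g * (a * A + b * B)))
      + 3 * δ * (A ^ 2 + B ^ 2)
      + (1 / (4 * δ) + 1 / (4 * η)) * ((-L + τ * al * b - τ ^ 2 * a) ^ 2 + (-N - τ * al * a - τ ^ 2 * b) ^ 2)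
      + M / (4 * δ) * (τ ^ 2 * al * (a ^ 2 + b ^ 2))
      + η * (τ ^ 2 * (a ^ 2 + b ^ 2)) + 1 / (4 * δ) * (a ^ 2 + b ^ 2) := by
  set f := -L + τ * al * b - τ ^ 2 * a with hf
  set h := -N - τ * al * a - τ ^ 2 * b with hh
  have h1 := young_aux δ g A f B h hδ hg
  have h2 := young_aux δ g A (-(τ * al * b)) B (τ * al * a) hδ hg
  have h3 := young_aux η (g' / 2) a f b h hη (by rw [abs_div]; norm_num; linarith)
  have h4 := young_aux δ (1 / 2 * ε ^ 2 * g) A a B b hδ (by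
    rw [abs_mul, abs_mul, abs_pow]
    have : |ε| ^ 2 ≤ 1 := pow_le_one₀ (abs_nonneg _) hε
    have h5 : |ε| ^ 2 * |g| ≤ 1 := mul_le_one₀ this (abs_nonneg _) hg
    have : |(1 / 2 : ℝ)| = 1 / 2 := abs_of_pos (by norm_num)
    rw [this]; linarith)
  have h5 : 1 / (4 * δ) * ((-(τ * al * b)) ^ 2 + (τ * al * a) ^ 2) ≤ M / (4 * δ) * (τ ^ 2 * al * (a ^ 2 + b ^ 2)) := by
    have e : M / (4 * δ) * (τ ^ 2 * al * (a ^ 2 + b ^ 2)) - 1 / (4 * δ) * ((-(τ * al * b)) ^ 2 + (τ * al * a) ^ 2)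
       = 1 / (4 * δ) * ((M - al) * (τ ^ 2 * al * (a ^ 2 + b ^ 2))) := by field_simp; ring
    have : 0 ≤ 1 / (4 * δ) * ((M - al) * (τ ^ 2 * al * (a ^ 2 + b ^ 2))) := by
      have : 0 ≤ M - al := by linarith
      positivity
    linarith
  have hτ2 : 1 ≤ τ ^ 2 := by rw [← sq_abs]; nlinarith
  have h6 : η * (a ^ 2 + b ^ 2) ≤ η * (τ ^ 2 * (a ^ 2 + b ^ 2)) := by
    apply mul_le_mul_of_nonneg_left _ hη.le
    nlinarith [sq_nonneg a, sq_nonneg b]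
  have eL : L = τ * al * b - τ ^ 2 * a - f := by rw [hf]; ring
  have eN : N = -(τ * al * a) - τ ^ 2 * b - h := by rw [hh]; ring
  clear_value f h
  subst eL eN
  linarith

set_option maxHeartbeats 2000000 in
lemma pt_main (d : ℕ) (e K M c₀ η τ al w a b L N ε: ℝ) (A B wv g g' : Fin d → ℝ)
    (he : 0 < e) (hη : 0 < η) (hτ : 1 ≤ |τ|) (hc₀ : 0 < c₀)
    (hal : 0 ≤ al) (hM : al ≤ M) (hg : ∀ j, |g j| ≤ 1) (hg' : ∀ j, |g' j| ≤ 1) (hε : |ε| ≤ 1)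
    (hw0 : 0 ≤ w) (hw1 : w ≤ 1) (hwal : c₀ * w ≤ al) (hK : 0 < K) (hwv : ∀ j, |wv j| ≤ K)
    (hpos : ∀ j, e ≤ g' j + 2 * w) :
    e / 2 * (τ ^ 2 * (a ^ 2 + b ^ 2)) ≤
      (∑ j, ((g j * (A j * L + B j * N) + g' j * (A j ^ 2 + B j ^ 2) - 1 / 2 * g' j * (∑ i, (A i ^ 2 + B i ^ 2)))
        + 1 / 2 * (g' j * ((∑ i, (A i ^ 2 + B i ^ 2)) + a * L + b * N) - ε ^ 2 * g j * (a * A j + b * B j))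
        + τ ^ 2 * (1 / 2 * g' j * (a ^ 2 + b ^ 2) + g j * (a * A j + b * B j))))
      + 2 * (w * ((∑ i, (A i ^ 2 + B i ^ 2)) + a * L + b * N) + ∑ j, wv j * (a * A j + b * B j))
      - (d * (M / (4 * (e / 16))) + 2 / c₀) * τ * (a * N - b * L)
      - e / 2 * ((∑ i, (A i ^ 2 + B i ^ 2)) + a * L + b * N)
      + (d * (1 / (4 * (e / 16)) + 1 / (4 * η)) + (d * (M / (4 * (e / 16))) + 2 / c₀) * (1 / (4 * η)) + 2 * (1 / (4 * η))
          + e / 2 * (1 / (4 * η)))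
         * ((-L + τ * al * b - τ ^ 2 * a) ^ 2 + (-N - τ * al * a - τ ^ 2 * b) ^ 2)
      + (d + (d * (M / (4 * (e / 16))) + 2 / c₀) + 2 + e / 2) * (η * (τ ^ 2 * (a ^ 2 + b ^ 2)))
      + (d * (1 / (4 * (e / 16))) + 2 * d * (K ^ 2 * (1 / (4 * (e / 16))))) * (a ^ 2 + b ^ 2) := by
  set P := ∑ i, (A i ^ 2 + B i ^ 2) with hP
  have hδ : 0 < e / 16 := by positivity
  have hM0 : 0 ≤ M := hal.trans hM
  generalize hdd : e / 16 = δ at *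
  have hmor : ∑ j, g' j * (A j ^ 2 + B j ^ 2) ≤
      (∑ j, ((g j * (A j * L + B j * N) + g' j * (A j ^ 2 + B j ^ 2) - 1 / 2 * g' j * P)
        + 1 / 2 * (g' j * (P + a * L + b * N) - ε ^ 2 * g j * (a * A j + b * B j))
        + τ ^ 2 * (1 / 2 * g' j * (a ^ 2 + b ^ 2) + g j * (a * A j + b * B j))))
      + (3 * δ * P + d * ((1 / (4 * δ) + 1 / (4 * η)) * ((-L + τ * al * b - τ ^ 2 * a) ^ 2 + (-N - τ * al * a - τ ^ 2 * b) ^ 2)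
      + M / (4 * δ) * (τ ^ 2 * al * (a ^ 2 + b ^ 2))
      + η * (τ ^ 2 * (a ^ 2 + b ^ 2)) + 1 / (4 * δ) * (a ^ 2 + b ^ 2))) := by
    have hc : ∀ c : ℝ, (d : ℝ) * c = ∑ _j : Fin d, c := by intro c; simp
    rw [hc]
    conv_rhs => rw [hP, Finset.mul_sum, ← Finset.sum_add_distrib, ← Finset.sum_add_distrib]
    apply Finset.sum_le_sum
    intro j _
    rw [← hP]
    have := pt_mor δ η τ al M (g j) (g' j) ε a b (A j) (B j) L N P hδ hη hτ hal hM (hg j) (hg' j) hε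
    linarith
  have hdamp := pt_damp η τ al a b L N hη
  have hgw : ∑ j, -(wv j) * (a * A j + b * B j) ≤ δ * P + d * (K ^ 2 * (1 / (4 * δ)) * (a ^ 2 + b ^ 2)) := by
    calc _ ≤ ∑ j, (δ * (A j ^ 2 + B j ^ 2) + (K ^ 2 * (1 / (4 * δ)) * (a ^ 2 + b ^ 2))) := by
          apply Finset.sum_le_sum
          intro j _
          have := young_aux δ (-(wv j) / K) (A j) (K * a) (B j) (K * b) hδ (by
            rw [abs_div, abs_neg, abs_of_pos hK, div_le_one hK]; exact hwv j)
          have e1 : -(wv j) / K * (A j * (K * a) + B j * (K * b)) = -(wv j) * (a * A j + b * B j) := by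
            field_simp
          rw [e1] at this
          linarith
      _ = _ := by
          rw [Finset.sum_add_distrib, ← Finset.mul_sum]
          simp [hP]
  have hposS : e * P ≤ ∑ j, g' j * (A j ^ 2 + B j ^ 2) + 2 * (w * P) := by
    have : e * P ≤ ∑ j, (g' j + 2 * w) * (A j ^ 2 + B j ^ 2) := by
      rw [hP, Finset.mul_sum]
      exact Finset.sum_le_sum fun j _ => mul_le_mul_of_nonneg_right (hpos j) (by positivity)
    simp only [add_mul, Finset.sum_add_distrib] at this ⊢
    rw [← Finset.mul_sum, ← hP] at this
    linarith
  have hP0 : 0 ≤ P := Finset.sum_nonneg fun j _ => by positivity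
  set f := -L + τ * al * b - τ ^ 2 * a with hf
  set h := -N - τ * al * a - τ ^ 2 * b with hh
  have hτ2 : 1 ≤ τ ^ 2 := by rw [← sq_abs]; nlinarith
  have h6 : η * (a ^ 2 + b ^ 2) ≤ η * (τ ^ 2 * (a ^ 2 + b ^ 2)) := by
    apply mul_le_mul_of_nonneg_left _ hη.le
    nlinarith [sq_nonneg a, sq_nonneg b]
  have y1 := young_aux η w a f b h hη (by rw [abs_of_nonneg hw0]; exact hw1)
  have y2 := young_aux η (-1) a f b h hη (by simp)
  have hwn : w * (τ ^ 2 * (a ^ 2 + b ^ 2)) ≤ 1 / c₀ * (τ ^ 2 * al * (a ^ 2 + b ^ 2)) := by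
    have : w ≤ al / c₀ := by rw [le_div_iff₀ hc₀]; linarith
    calc _ ≤ al / c₀ * (τ ^ 2 * (a ^ 2 + b ^ 2)) := mul_le_mul_of_nonneg_right this (by positivity)
      _ = _ := by ring
  simp only [neg_mul, Finset.sum_neg_distrib] at hgw
  have hwP : w * P ≤ (w * (P + a * L + b * N) + ∑ j, wv j * (a * A j + b * B j))
     + η * (τ ^ 2 * (a ^ 2 + b ^ 2)) + 1 / (4 * η) * (f ^ 2 + h ^ 2)
     + 1 / c₀ * (τ ^ 2 * al * (a ^ 2 + b ^ 2)) + δ * P + d * (K ^ 2 * (1 / (4 * δ)) * (a ^ 2 + b ^ 2)) := by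
    have : w * (a * L + b * N) = - (w * (a * f + b * h)) - w * (τ ^ 2 * (a ^ 2 + b ^ 2)) := by
      rw [hf, hh]; ring
    linarith
  have hU : τ ^ 2 * (a ^ 2 + b ^ 2) ≥ 0 := by positivity
  have hUP : τ ^ 2 * (a ^ 2 + b ^ 2) ≤ P + η * (τ ^ 2 * (a ^ 2 + b ^ 2)) + 1 / (4 * η) * (f ^ 2 + h ^ 2)
      - (P + a * L + b * N) := by
    have : (a * L + b * N) = - ((a * f + b * h)) - (τ ^ 2 * (a ^ 2 + b ^ 2)) := by
      rw [hf, hh]; ring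
    linarith
  have hCa : 0 ≤ d * (M / (4 * δ)) + 2 / c₀ := by positivity
  have k1 := mul_le_mul_of_nonneg_left hdamp hCa
  have k2 := mul_le_mul_of_nonneg_left hUP (by positivity : 0 ≤ e / 2)
  have k3 : 5 * δ * P ≤ e / 2 * P := mul_le_mul_of_nonneg_right (by linarith) hP0
  have e2 : 2 / c₀ = 2 * (1 / c₀) := by ring
  rw [e2] at k1 ⊢
  clear_value P f h
  linear_combination hmor + 2 * hwP + k1 + k2 + k3 + hposS

/-- real directional derivative -/
def dj {d : ℕ} (j : Fin d) (h : Ed d → ℝ) (x : Ed d) : ℝ :=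
  fderiv ℝ h x (EuclideanSpace.single j 1)

/-- integrable with zero integral -/
def Good {d : ℕ} (h : Ed d → ℝ) : Prop := Integrable h ∧ ∫ x, h x = 0

lemma Good.add {d : ℕ} {h k : Ed d → ℝ} (hh : Good h) (hk : Good k) :
    Good (fun x => h x + k x) :=
  ⟨hh.1.add hk.1, by rw [integral_add hh.1 hk.1, hh.2, hk.2, add_zero]⟩

lemma Good.smul {d : ℕ} {h : Ed d → ℝ} (c : ℝ) (hh : Good h) :
    Good (fun x => c * h x) :=
  ⟨hh.1.const_mul c, by rw [integral_const_mul, hh.2, mul_zero]⟩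

lemma Good.sum {d : ℕ} {ι : Type*} {s : Finset ι} {h : ι → Ed d → ℝ} (hh : ∀ i, Good (h i)) :
    Good (fun x => ∑ i ∈ s, h i x) :=
  ⟨integrable_finsetSum _ fun i _ => (hh i).1, by
    rw [integral_finsetSum _ fun i _ => (hh i).1]
    exact Finset.sum_eq_zero fun i _ => (hh i).2⟩

lemma dj_contDiff {d : ℕ} (j : Fin d) {h : Ed d → ℝ} (hh : ContDiff ℝ ∞ h) :
    ContDiff ℝ ∞ (dj j h) := by
  unfold dj
  exact (hh.fderiv_right (m := ∞) (by simp)).clm_apply contDiff_const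

lemma dj_supp {d : ℕ} (j : Fin d) {h : Ed d → ℝ} (hh : HasCompactSupport h) :
    HasCompactSupport (dj j h) :=
  hh.fderiv_apply (𝕜 := ℝ) _

lemma good_dj {d : ℕ} (j : Fin d) {h : Ed d → ℝ} (hh : ContDiff ℝ ∞ h) (hc : HasCompactSupport h) :
    Good (dj j h) := by
  have hi : Integrable (dj j h) := (dj_contDiff j hh).continuous.integrable_of_hasCompactSupport (dj_supp j hc)
  refine ⟨hi, ?_⟩
  have := integral_mul_fderiv_eq_neg_fderiv_mul_of_integrable (μ := (volume : Measure (Ed d)))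
    (f := fun _ => (1 : ℝ)) (g := h) (v := EuclideanSpace.single j 1)
    (by simp) (by simp only [one_mul]; exact hi)
    (by simpa using hh.continuous.integrable_of_hasCompactSupport hc) (fun x _ => differentiableAt_const _)
    (fun x _ => (hh.differentiable (by simp)).differentiableAt)
  simpa [dj] using this

lemma dj_mul {d : ℕ} (j : Fin d) {h k : Ed d → ℝ} (hh : ContDiff ℝ ∞ h) (hk : ContDiff ℝ ∞ k) (x : Ed d) :
    dj j (fun y => h y * k y) x = dj j h x * k x + h x * dj j k x := by
  unfold dj
  rw [fderiv_fun_mul (hh.differentiable (by simp)).differentiableAt (hk.differentiable (by simp)).differentiableAt]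
  simp
  ring

lemma dj_comm {d : ℕ} (i j : Fin d) {h : Ed d → ℝ} (hh : ContDiff ℝ ∞ h) (x : Ed d) :
    dj i (dj j h) x = dj j (dj i h) x := by
  have hs := (hh.contDiffAt (x := x)).isSymmSndFDerivAt (by simp; exact WithTop.coe_le_coe.2 (le_top (a := (2 : ℕ∞))))
  have hd : DifferentiableAt ℝ (fderiv ℝ h) x :=
    ((hh.fderiv_right (m := ∞) (by simp)).differentiable (by simp)).differentiableAt
  have key : ∀ i j : Fin d, dj i (dj j h) x
      = fderiv ℝ (fderiv ℝ h) x (EuclideanSpace.single i 1) (EuclideanSpace.single j 1) := by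
    intro i j
    unfold dj
    rw [fderiv_clm_apply hd (differentiableAt_const _)]
    simp
  rw [key, key]
  exact hs _ _

/-- energy identity with weight -/
lemma good_energy {d : ℕ} {ρ a : Ed d → ℝ} (hρ : ContDiff ℝ ∞ ρ) (ha : ContDiff ℝ ∞ a)
    (hc : HasCompactSupport a) :
    Good (fun x => ∑ j, (ρ x * (dj j a x) ^ 2 + ρ x * a x * dj j (dj j a) x
      + dj j ρ x * (a x * dj j a x))) := by
  apply Good.sum
  intro j
  have h1 := good_dj j (h := fun x => ρ x * (a x * dj j a x)) (hρ.mul (ha.mul (dj_contDiff j ha)))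
    ((hc.mul_right).mul_left)
  convert h1 using 2 with x
  rw [dj_mul j hρ (ha.mul (dj_contDiff j ha)), dj_mul j ha (dj_contDiff j ha)]
  ring

lemma good_im {d : ℕ} {a b : Ed d → ℝ} (ha : ContDiff ℝ ∞ a) (hb : ContDiff ℝ ∞ b)
    (hca : HasCompactSupport a) (hcb : HasCompactSupport b) :
    Good (fun x => ∑ j, (a x * dj j (dj j b) x - b x * dj j (dj j a) x)) := by
  apply Good.sum
  intro j
  have h1 := good_dj j (h := fun x => a x * dj j b x) (ha.mul (dj_contDiff j hb)) hca.mul_right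
  have h2 := good_dj j (h := fun x => b x * dj j a x) (hb.mul (dj_contDiff j ha)) hcb.mul_right
  convert h1.add (h2.smul (-1)) using 2 with x
  rw [dj_mul j ha (dj_contDiff j hb), dj_mul j hb (dj_contDiff j ha)]
  ring

lemma good_mor {d : ℕ} (j : Fin d) {g a : Ed d → ℝ} (hg : ContDiff ℝ ∞ g) (ha : ContDiff ℝ ∞ a)
    (hc : HasCompactSupport a) :
    Good (fun x => ∑ i, (dj i g x * (dj j a x * dj i a x) + g x * dj j a x * dj i (dj i a) x
      - 1 / 2 * dj j g x * (dj i a x) ^ 2)) := by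
  apply Good.sum
  intro i
  have hi := dj_contDiff i ha
  have hj := dj_contDiff j ha
  have h1 := good_dj i (h := fun x => g x * (dj j a x * dj i a x)) (hg.mul (hj.mul hi))
    ((dj_supp j hc).mul_right.mul_left)
  have h2 := good_dj j (h := fun x => g x * (dj i a x * dj i a x)) (hg.mul (hi.mul hi))
    ((dj_supp i hc).mul_right.mul_left)
  convert h1.add (h2.smul (-1 / 2)) using 2 with x
  rw [dj_mul i hg (hj.mul hi), dj_mul j hg (hi.mul hi), dj_mul i hj hi, dj_mul j hi hi, dj_comm i j ha]
  ring

lemma good_sq {d : ℕ} (j : Fin d) {g a : Ed d → ℝ} (hg : ContDiff ℝ ∞ g) (ha : ContDiff ℝ ∞ a)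
    (hc : HasCompactSupport a) :
    Good (fun x => 1 / 2 * dj j g x * (a x) ^ 2 + g x * (a x * dj j a x)) := by
  have h2 := good_dj j (h := fun x => g x * (a x * a x)) (hg.mul (ha.mul ha))
    (hc.mul_right.mul_left)
  convert h2.smul (1 / 2) using 2 with x
  rw [dj_mul j hg (ha.mul ha), dj_mul j ha ha]
  ring

lemma dj_sin {d : ℕ} (ε : ℝ) (i j : Fin d) (x : Ed d) :
    dj i (fun y : Ed d => Real.sin (ε * y j)) x = if i = j then ε * Real.cos (ε * x j) else 0 := by
  unfold dj
  have h0 : HasFDerivAt (fun y : Ed d => y j) (EuclideanSpace.proj j : Ed d →L[ℝ] ℝ) x :=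
    (EuclideanSpace.proj j : Ed d →L[ℝ] ℝ).hasFDerivAt
  have h := ((h0.const_mul ε).sin).fderiv
  rw [h]
  by_cases hij : i = j
  · subst hij; simp; ring
  · simp [hij, Ne.symm hij]

lemma dj_cos {d : ℕ} (ε : ℝ) (i j : Fin d) (x : Ed d) :
    dj i (fun y : Ed d => ε * Real.cos (ε * y j)) x
      = if i = j then - ε ^ 2 * Real.sin (ε * x j) else 0 := by
  unfold dj
  have h0 : HasFDerivAt (fun y : Ed d => y j) (EuclideanSpace.proj j : Ed d →L[ℝ] ℝ) x :=
    (EuclideanSpace.proj j : Ed d →L[ℝ] ℝ).hasFDerivAt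
  have h := (((h0.const_mul ε).cos).const_mul ε).fderiv
  rw [h]
  by_cases hij : i = j
  · subst hij; simp; ring
  · simp [hij, Ne.symm hij]

lemma sin_contDiff {d : ℕ} (ε : ℝ) (j : Fin d) :
    ContDiff ℝ ∞ (fun y : Ed d => Real.sin (ε * y j)) := by fun_prop

lemma cos_contDiff {d : ℕ} (ε : ℝ) (j : Fin d) :
    ContDiff ℝ ∞ (fun y : Ed d => ε * Real.cos (ε * y j)) := by fun_prop

lemma pd_re {d : ℕ} {u : Ed d → ℂ} (hu : ContDiff ℝ ∞ u) (j : Fin d) (x : Ed d) :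
    (partialDeriv u j x).re = dj j (fun y => (u y).re) x := by
  unfold dj partialDeriv
  have h := (Complex.reCLM.hasFDerivAt.comp x ((hu.differentiable (by simp)).differentiableAt (x := x)).hasFDerivAt).fderiv
  have e : (Complex.reCLM ∘ u) = fun y => (u y).re := rfl
  rw [e] at h
  rw [h]; rfl

lemma pd_im {d : ℕ} {u : Ed d → ℂ} (hu : ContDiff ℝ ∞ u) (j : Fin d) (x : Ed d) :
    (partialDeriv u j x).im = dj j (fun y => (u y).im) x := by
  unfold dj partialDeriv
  have h := (Complex.imCLM.hasFDerivAt.comp x ((hu.differentiable (by simp)).differentiableAt (x := x)).hasFDerivAt).fderiv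
  have e : (Complex.imCLM ∘ u) = fun y => (u y).im := rfl
  rw [e] at h
  rw [h]; rfl

lemma pd_contDiff {d : ℕ} {u : Ed d → ℂ} (hu : ContDiff ℝ ∞ u) (j : Fin d) :
    ContDiff ℝ ∞ (partialDeriv u j) := by
  unfold partialDeriv
  exact (hu.fderiv_right (m := ∞) (by simp)).clm_apply contDiff_const

lemma lap_re {d : ℕ} {u : Ed d → ℂ} (hu : ContDiff ℝ ∞ u) (x : Ed d) :
    (laplacian' u x).re = ∑ j, dj j (dj j (fun y => (u y).re)) x := by
  unfold laplacian'
  rw [Complex.re_sum]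
  refine Finset.sum_congr rfl fun j _ => ?_
  rw [pd_re (pd_contDiff hu j)]
  congr 1
  funext y
  exact pd_re hu j y

lemma lap_im {d : ℕ} {u : Ed d → ℂ} (hu : ContDiff ℝ ∞ u) (x : Ed d) :
    (laplacian' u x).im = ∑ j, dj j (dj j (fun y => (u y).im)) x := by
  unfold laplacian'
  rw [Complex.im_sum]
  refine Finset.sum_congr rfl fun j _ => ?_
  rw [pd_im (pd_contDiff hu j)]
  congr 1
  funext y
  exact pd_im hu j y

lemma good_T1 {d : ℕ} (ε : ℝ) (j : Fin d) {a b : Ed d → ℝ} (ha : ContDiff ℝ ∞ a) (hb : ContDiff ℝ ∞ b)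
    (hca : HasCompactSupport a) (hcb : HasCompactSupport b) :
    Good (fun x => Real.sin (ε * x j) * (dj j a x * (∑ i, dj i (dj i a) x) + dj j b x * (∑ i, dj i (dj i b) x))
      + ε * Real.cos (ε * x j) * (dj j a x ^ 2 + dj j b x ^ 2)
      - 1 / 2 * (ε * Real.cos (ε * x j)) * (∑ i, (dj i a x ^ 2 + dj i b x ^ 2))) := by
  convert (good_mor j (sin_contDiff ε j) ha hca).add (good_mor j (sin_contDiff ε j) hb hcb) using 2 with x
  simp only [dj_sin, Finset.sum_add_distrib, Finset.sum_sub_distrib, ite_mul, zero_mul,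
    Finset.sum_ite_eq', Finset.mem_univ, if_true, ← Finset.mul_sum]
  ring

lemma good_T2 {d : ℕ} (ε : ℝ) (j : Fin d) {a b : Ed d → ℝ} (ha : ContDiff ℝ ∞ a) (hb : ContDiff ℝ ∞ b)
    (hca : HasCompactSupport a) (hcb : HasCompactSupport b) :
    Good (fun x => ε * Real.cos (ε * x j) * ((∑ i, (dj i a x ^ 2 + dj i b x ^ 2))
        + a x * (∑ i, dj i (dj i a) x) + b x * (∑ i, dj i (dj i b) x))
      - ε ^ 2 * Real.sin (ε * x j) * (a x * dj j a x + b x * dj j b x)) := by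
  convert (good_energy (cos_contDiff ε j) ha hca).add (good_energy (cos_contDiff ε j) hb hcb) using 2 with x
  simp only [dj_cos, Finset.sum_add_distrib, ite_mul, zero_mul,
    Finset.sum_ite_eq', Finset.mem_univ, if_true, ← Finset.mul_sum]
  ring

lemma good_T3 {d : ℕ} (ε : ℝ) (j : Fin d) {a b : Ed d → ℝ} (ha : ContDiff ℝ ∞ a) (hb : ContDiff ℝ ∞ b)
    (hca : HasCompactSupport a) (hcb : HasCompactSupport b) :
    Good (fun x => 1 / 2 * (ε * Real.cos (ε * x j)) * (a x ^ 2 + b x ^ 2)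
      + Real.sin (ε * x j) * (a x * dj j a x + b x * dj j b x)) := by
  convert (good_sq j (sin_contDiff ε j) ha hca).add (good_sq j (sin_contDiff ε j) hb hcb) using 2 with x
  simp only [dj_sin, if_true]
  ring

lemma good_T4 {d : ℕ} {w a b : Ed d → ℝ} (hw : ContDiff ℝ ∞ w) (ha : ContDiff ℝ ∞ a) (hb : ContDiff ℝ ∞ b)
    (hca : HasCompactSupport a) (hcb : HasCompactSupport b) :
    Good (fun x => w x * ((∑ i, (dj i a x ^ 2 + dj i b x ^ 2))
        + a x * (∑ i, dj i (dj i a) x) + b x * (∑ i, dj i (dj i b) x))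
      + ∑ j, dj j w x * (a x * dj j a x + b x * dj j b x)) := by
  convert (good_energy hw ha hca).add (good_energy hw hb hcb) using 2 with x
  simp only [mul_add, Finset.sum_add_distrib, Finset.mul_sum, mul_assoc]
  ring

lemma good_T5 {d : ℕ} {a b : Ed d → ℝ} (ha : ContDiff ℝ ∞ a) (hb : ContDiff ℝ ∞ b)
    (hca : HasCompactSupport a) (hcb : HasCompactSupport b) :
    Good (fun x => (∑ i, (dj i a x ^ 2 + dj i b x ^ 2))
        + a x * (∑ i, dj i (dj i a) x) + b x * (∑ i, dj i (dj i b) x)) := by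
  have h := good_T4 (w := fun _ => 1) contDiff_const ha hb hca hcb
  have e : ∀ j x, dj (d := d) j (fun _ => 1) x = 0 := by intro j x; simp [dj]
  simpa only [e, zero_mul, Finset.sum_const_zero, add_zero, one_mul] using h

lemma good_T6 {d : ℕ} {a b : Ed d → ℝ} (ha : ContDiff ℝ ∞ a) (hb : ContDiff ℝ ∞ b)
    (hca : HasCompactSupport a) (hcb : HasCompactSupport b) :
    Good (fun x => a x * (∑ i, dj i (dj i b) x) - b x * (∑ i, dj i (dj i a) x)) := by
  convert good_im ha hb hca hcb using 2 with x
  simp only [Finset.sum_sub_distrib, Finset.mul_sum]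

/-- The cutoff to the damping region. -/
lemma exists_cutoff {d : ℕ} (c₀ : ℝ) (hc₀ : 0 < c₀) (α : Ed d → ℝ) (hnonneg : ∀ x, 0 ≤ α x)
    (hinfty : ∃ B : Set (Ed d), Bornology.IsBounded B ∧ ∀ x ∉ B, c₀ ≤ α x) :
    ∃ (w : Ed d → ℝ) (K ε : ℝ), ContDiff ℝ ∞ w ∧ (∀ x, 0 ≤ w x) ∧ (∀ x, w x ≤ 1) ∧
      (∀ x, c₀ * w x ≤ α x) ∧ 0 < K ∧ (∀ j x, |dj j w x| ≤ K) ∧ 0 < ε ∧ ε ≤ 1 ∧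
      ∀ j x, ε / 2 ≤ ε * Real.cos (ε * x j) + 2 * w x := by
  obtain ⟨B, hB, hBα⟩ := hinfty
  obtain ⟨R, hR, hBR⟩ := hB.subset_closedBall_lt 0 0
  let φ : ContDiffBump (0 : Ed d) := ⟨R, R + 1, hR, by linarith⟩
  have hφ : ContDiff ℝ ∞ (φ : Ed d → ℝ) := φ.contDiff
  have hw : ContDiff ℝ ∞ (fun x => 1 - φ x) := contDiff_const.sub hφ
  have hbd : ∃ C, ∀ x, ‖fderiv ℝ (φ : Ed d → ℝ) x‖ ≤ C :=
    (φ.hasCompactSupport.fderiv (𝕜 := ℝ)).exists_bound_of_continuous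
      (hφ.continuous_fderiv (by simp))
  obtain ⟨C, hC⟩ := hbd
  have hR1 : 0 < R + 1 := by linarith
  refine ⟨fun x => 1 - φ x, |C| + 1, 1 / (R + 1), hw, fun x => by linarith [φ.le_one (x := x)],
    fun x => by linarith [φ.nonneg (x := x)], ?_, by positivity, ?_, by positivity, ?_, ?_⟩
  · intro x
    beta_reduce
    by_cases hx : x ∈ B
    · rw [φ.one_of_mem_closedBall (hBR hx)]; simpa using hnonneg x
    · have := hBα x hx
      nlinarith [φ.nonneg (x := x)]
  · intro j x
    unfold dj
    rw [fderiv_const_sub]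
    have h1 := (fderiv ℝ (φ : Ed d → ℝ) x).le_opNorm (EuclideanSpace.single j 1)
    simp only [EuclideanSpace.norm_single, norm_one, mul_one] at h1
    have := hC x
    simp only [neg_apply, abs_neg]
    rw [Real.norm_eq_abs] at h1
    linarith [le_abs_self C]
  · rw [div_le_one hR1]; linarith
  · intro j x
    have hε : 0 < 1 / (R + 1) := by positivity
    have hε1 : 1 / (R + 1) ≤ 1 := by rw [div_le_one hR1]; linarith
    beta_reduce
    by_cases hx : R + 1 ≤ dist x 0
    · have h0 : φ x = 0 := φ.zero_of_le_dist hx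
      rw [h0]
      have := Real.neg_one_le_cos (1 / (R + 1) * x j)
      nlinarith
    · push Not at hx
      rw [dist_zero_right] at hx
      have h1 : |x j| ≤ ‖x‖ := by
        simpa using PiLp.norm_apply_le x j
      have h2 : |1 / (R + 1) * x j| ≤ 1 := by
        rw [abs_mul, abs_of_pos hε, one_div, inv_mul_le_iff₀ hR1]; linarith
      have h3 : (1 / (R + 1) * x j) ^ 2 ≤ 1 := by
        rw [← sq_abs]; exact pow_le_one₀ (abs_nonneg _) h2
      have := Real.one_sub_sq_div_two_le_cos (x := 1 / (R + 1) * x j)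
      have h4 := φ.le_one (x := x)
      nlinarith

set_option maxHeartbeats 4000000 in
lemma main_pt {d : ℕ} (c₀ : ℝ) (hc₀ : 0 < c₀)
    (α : Ed d → ℝ) (M : ℝ) (hM : ∀ x, α x ≤ M) (hnonneg : ∀ x, 0 ≤ α x)
    (hinfty : ∃ B : Set (Ed d), Bornology.IsBounded B ∧ ∀ x ∉ B, c₀ ≤ α x) :
    ∃ τ₀ : ℝ, 0 < τ₀ ∧ ∃ k C : ℝ, 0 < k ∧ 0 ≤ C ∧ ∀ τ : ℝ, τ₀ ≤ |τ| → ∀ a b : Ed d → ℝ,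
      ContDiff ℝ ∞ a → ContDiff ℝ ∞ b → HasCompactSupport a → HasCompactSupport b →
      ∃ H : Ed d → ℝ, Good H ∧ ∀ x, k * (τ ^ 2 * (a x ^ 2 + b x ^ 2)) ≤ H x
        + C * ((-(∑ i, dj i (dj i a) x) + τ * α x * b x - τ ^ 2 * a x) ^ 2
          + (-(∑ i, dj i (dj i b) x) - τ * α x * a x - τ ^ 2 * b x) ^ 2) := by
  obtain ⟨w, K, ε, hw, hw0, hw1, hwα, hK, hwK, hε, hε1, hpos⟩ := exists_cutoff c₀ hc₀ α hnonneg hinfty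
  have hM0 : 0 ≤ M := (hnonneg 0).trans (hM 0)
  set e := ε / 2 with he
  have he0 : 0 < e := by positivity
  set Ca := d * (M / (4 * (e / 16))) + 2 / c₀ with hCa
  have hCa0 : 0 ≤ Ca := by positivity
  set C3 := d + Ca + 2 + e / 2 with hC3
  have hC30 : 0 < C3 := by positivity
  set C4 := d * (1 / (4 * (e / 16))) + 2 * d * (K ^ 2 * (1 / (4 * (e / 16)))) with hC4
  have hC40 : 0 ≤ C4 := by positivity
  set η := e / (8 * C3) with hη
  have hη0 : 0 < η := by positivity
  set C5 := d * (1 / (4 * (e / 16)) + 1 / (4 * η)) + Ca * (1 / (4 * η)) + 2 * (1 / (4 * η))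
          + e / 2 * (1 / (4 * η)) with hC5
  have hC50 : 0 ≤ C5 := by positivity
  refine ⟨1 + 8 * C4 / e, by positivity, e / 4, C5, by positivity, hC50, ?_⟩
  intro τ hτ a b ha hb hca hcb
  refine ⟨_, ((((Good.sum (s := Finset.univ) fun j => ((good_T1 ε j ha hb hca hcb).add
    ((good_T2 ε j ha hb hca hcb).smul (1 / 2))).add ((good_T3 ε j ha hb hca hcb).smul (τ ^ 2))).add
    ((good_T4 hw ha hb hca hcb).smul 2)).add ((good_T6 ha hb hca hcb).smul (-(Ca * τ)))).add
    ((good_T5 ha hb hca hcb).smul (-(e / 2)))), ?_⟩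
  intro x
  have h8 : 0 ≤ 8 * C4 / e := by positivity
  have hτ1 : 1 ≤ |τ| := by linarith
  have := pt_main d e K M c₀ η τ (α x) (w x) (a x) (b x) (∑ i, dj i (dj i a) x) (∑ i, dj i (dj i b) x) ε
    (fun j => dj j a x) (fun j => dj j b x) (fun j => dj j w x) (fun j => Real.sin (ε * x j))
    (fun j => ε * Real.cos (ε * x j)) he0 hη0 hτ1 hc₀ (hnonneg x) (hM x)
    (fun j => Real.abs_sin_le_one _) (fun j => by
      rw [abs_mul, abs_of_pos hε]; exact mul_le_one₀ hε1 (abs_nonneg _) (Real.abs_cos_le_one _))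
    (by rw [abs_of_pos hε]; exact hε1) (hw0 x) (hw1 x) (hwα x) hK (fun j => hwK j x) (fun j => hpos j x)
  rw [← hCa, ← hC3, ← hC4, ← hC5] at this
  have hτ2 : 8 * C4 / e ≤ τ ^ 2 := by rw [← sq_abs]; nlinarith
  have h4 : C4 * (a x ^ 2 + b x ^ 2) ≤ e / 8 * (τ ^ 2 * (a x ^ 2 + b x ^ 2)) := by
    have : C4 ≤ e / 8 * τ ^ 2 := by
      rw [div_le_iff₀ he0] at hτ2; linarith
    calc _ ≤ (e / 8 * τ ^ 2) * (a x ^ 2 + b x ^ 2) := mul_le_mul_of_nonneg_right this (by positivity)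
      _ = _ := by ring
  have h3 : C3 * (η * (τ ^ 2 * (a x ^ 2 + b x ^ 2))) = e / 8 * (τ ^ 2 * (a x ^ 2 + b x ^ 2)) := by
    rw [hη]; field_simp
  rw [h3] at this
  linear_combination this + h4

lemma integrable_F {d : ℕ} (α : Ed d → ℝ) (hα : Measurable α) (M : ℝ) (hM : ∀ x, |α x| ≤ M) (τ : ℝ)
    (a b : Ed d → ℝ) (ha : ContDiff ℝ ∞ a) (hb : ContDiff ℝ ∞ b) (hca : HasCompactSupport a)
    (hcb : HasCompactSupport b) :
    Integrable (fun x => (-(∑ i, dj i (dj i a) x) + τ * α x * b x - τ ^ 2 * a x) ^ 2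
          + (-(∑ i, dj i (dj i b) x) - τ * α x * a x - τ ^ 2 * b x) ^ 2) := by
  have cl : ∀ {h : Ed d → ℝ}, ContDiff ℝ ∞ h → Continuous (fun x => ∑ i, dj i (dj i h) x) := fun hh =>
    continuous_finsetSum _ fun i _ => (dj_contDiff i (dj_contDiff i hh)).continuous
  have sl : ∀ {h : Ed d → ℝ}, HasCompactSupport h → HasCompactSupport (fun x => ∑ i, dj i (dj i h) x) := by
    intro h hh
    refine hh.mono' (Function.support_subset_iff'.2 fun x hx => ?_)
    refine Finset.sum_eq_zero fun i _ => ?_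
    have h1 : x ∉ tsupport (dj i h) := fun h' => hx (tsupport_fderiv_apply_subset ℝ _ h')
    have h2 : x ∉ tsupport (dj i (dj i h)) := fun h' => h1 (tsupport_fderiv_apply_subset ℝ _ h')
    exact image_eq_zero_of_notMem_tsupport h2
  set L := fun x => ∑ i, dj i (dj i a) x with hL
  set N := fun x => ∑ i, dj i (dj i b) x with hN
  have cL : Continuous L := cl ha
  have cN : Continuous N := cl hb
  have sL : HasCompactSupport L := sl hca
  have sN : HasCompactSupport N := sl hcb
  have ca := ha.continuous
  have cb := hb.continuous
  have sp : HasCompactSupport (fun x => -L x + (-τ ^ 2) * a x) := (sL.neg).add (hca.mul_left (f := fun _ => -τ ^ 2))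
  have sq : HasCompactSupport (fun x => -N x + (-τ ^ 2) * b x) := (sN.neg).add (hcb.mul_left (f := fun _ => -τ ^ 2))
  have i1 : Integrable (fun x => (-L x + (-τ ^ 2) * a x) * (-L x + (-τ ^ 2) * a x)
      + (-N x + (-τ ^ 2) * b x) * (-N x + (-τ ^ 2) * b x)) :=
    Continuous.integrable_of_hasCompactSupport (by fun_prop) (sp.mul_right.add sq.mul_right)
  have i2 : Integrable (fun x => (-L x + (-τ ^ 2) * a x) * (2 * τ * b x)
      + (-N x + (-τ ^ 2) * b x) * (-2 * τ * a x)) :=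
    Continuous.integrable_of_hasCompactSupport (by fun_prop) (sp.mul_right.add sq.mul_right)
  have i3 : Integrable (fun x => a x * (τ ^ 2 * a x) + b x * (τ ^ 2 * b x)) :=
    Continuous.integrable_of_hasCompactSupport (by fun_prop) (hca.mul_right.add hcb.mul_right)
  have j2 := i2.bdd_mul (c := M) hα.aestronglyMeasurable (Filter.Eventually.of_forall hM)
  have j3 := (i3.bdd_mul (c := M) hα.aestronglyMeasurable (Filter.Eventually.of_forall hM)).bdd_mul (c := M)
    hα.aestronglyMeasurable (Filter.Eventually.of_forall hM)
  refine ((i1.add j2).add j3).congr (Filter.Eventually.of_forall fun x => ?_)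
  simp only [Pi.add_apply]
  ring

/-- **High frequency resolvent estimate on `ℝ^d` with damping at infinity (a priori form).** -/
theorem high_freq_resolvent_estimate
    (d : ℕ) (hd : 1 ≤ d) (c₀ : ℝ) (hc₀ : 0 < c₀)
    (α : Ed d → ℝ) (hmeas : Measurable α) (hbdd : ∃ M : ℝ, ∀ x, |α x| ≤ M)
    (hnonneg : ∀ x, 0 ≤ α x)
    (hinfty : ∃ B : Set (Ed d), Bornology.IsBounded B ∧ ∀ x ∉ B, c₀ ≤ α x) :
    ∃ τ₀ : ℝ, 0 < τ₀ ∧ ∃ c : ℝ, 0 ≤ c ∧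
      ∀ τ : ℝ, τ₀ ≤ |τ| →
        ∀ u : Ed d → ℂ, ContDiff ℝ ∞ u → HasCompactSupport u →
          l2Norm u ≤ (c / |τ|) *
            l2Norm (fun x => -laplacian' u x - Complex.I * (τ : ℂ) * (α x : ℂ) * u x
              - (τ : ℂ) ^ 2 * u x) := by
  obtain ⟨M, hM⟩ := hbdd
  obtain ⟨τ₀, hτ₀, k, C, hk, hC, hmain⟩ := main_pt c₀ hc₀ α M (fun x => (le_abs_self _).trans (hM x)) hnonneg hinfty
  refine ⟨τ₀, hτ₀, Real.sqrt (C / k), Real.sqrt_nonneg _, ?_⟩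
  intro τ hτ u hu hcu
  have hτpos : 0 < |τ| := hτ₀.trans_le hτ
  have ha : ContDiff ℝ ∞ (fun x => (u x).re) := Complex.reCLM.contDiff.comp hu
  have hb : ContDiff ℝ ∞ (fun x => (u x).im) := Complex.imCLM.contDiff.comp hu
  have hca : HasCompactSupport (fun x => (u x).re) := hcu.comp_left (g := Complex.re) rfl
  have hcb : HasCompactSupport (fun x => (u x).im) := hcu.comp_left (g := Complex.im) rfl
  obtain ⟨H, hH, hpt⟩ := hmain τ hτ _ _ ha hb hca hcb
  have hF := integrable_F α hmeas M hM τ _ _ ha hb hca hcb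
  have eF : ∀ x, ‖-laplacian' u x - Complex.I * (τ : ℂ) * (α x : ℂ) * u x - (τ : ℂ) ^ 2 * u x‖ ^ 2
      = (-(∑ i, dj i (dj i fun y => (u y).re) x) + τ * α x * (u x).im - τ ^ 2 * (u x).re) ^ 2
          + (-(∑ i, dj i (dj i fun y => (u y).im) x) - τ * α x * (u x).re - τ ^ 2 * (u x).im) ^ 2 := by
    intro x
    rw [← lap_re hu, ← lap_im hu, ← Complex.normSq_eq_norm_sq, Complex.normSq_apply]
    have e2 : ((τ : ℂ) ^ 2) = ((τ ^ 2 : ℝ) : ℂ) := by push_cast; rfl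
    rw [e2]
    simp only [Complex.sub_re, Complex.sub_im, Complex.neg_re, Complex.neg_im, Complex.mul_re, Complex.mul_im,
      Complex.I_re, Complex.I_im, Complex.ofReal_re, Complex.ofReal_im]
    ring
  have eu : ∀ x, ‖u x‖ ^ 2 = (u x).re ^ 2 + (u x).im ^ 2 := by
    intro x
    rw [← Complex.normSq_eq_norm_sq, Complex.normSq_apply]; ring
  unfold l2Norm
  simp only [eF, eu]
  have hui : Integrable (fun x => (u x).re ^ 2 + (u x).im ^ 2) := by
    have : Integrable (fun x => (u x).re * (u x).re + (u x).im * (u x).im) :=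
      Continuous.integrable_of_hasCompactSupport
        ((ha.continuous.mul ha.continuous).add (hb.continuous.mul hb.continuous))
        (hca.mul_right.add hcb.mul_right)
    simpa only [sq] using this
  have hint := integral_mono ((hui.const_mul (τ ^ 2)).const_mul k) (hH.1.add (hF.const_mul C)) hpt
  simp only [Pi.add_apply] at hint
  rw [integral_add hH.1 (hF.const_mul C), hH.2, zero_add, integral_const_mul, integral_const_mul,
    integral_const_mul] at hint
  have e3 : Real.sqrt (C / k) / |τ| = Real.sqrt (C / k / τ ^ 2) := by
    rw [Real.sqrt_div' _ (sq_nonneg τ), Real.sqrt_sq_eq_abs]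
  have hτ2 : 0 < τ ^ 2 := by rw [← sq_abs]; positivity
  rw [e3, ← Real.sqrt_mul (by positivity)]
  apply Real.sqrt_le_sqrt
  rw [div_div, div_mul_eq_mul_div, le_div_iff₀ (by positivity)]
  linarith

end
end

section
/- Weyl's essential spectrum theorem under relatively compact perturbation (bounded-operator case). Let H be a complex Hilbert space, and let A and B be bounded linear operators on H such that B − A is compact. For a bounded operator T, say that λ belongs to the discrete spectrum of T if λ is an isolated point of the spectrum σ(T) and, for some r > 0 with σ(T) ∩ {σ : |σ − λ| ≤ 2r} = {λ}, the Riesz projection (2πi)^{−1} ∮_{|σ−λ|=r} (σ − T)^{−1} dσ has finite rank; define the essential spectrum σ_ess(T) = σ(T) \ σ_disc(T). Let U be a connected component of ℂ \ σ_ess(A). If U contains a point belonging to the resolvent set of A and to the resolvent set of B, then U ∩ σ_ess(B) = ∅. -/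
open MeasureTheory

noncomputable section

/-- The Riesz projection of a bounded operator `T` associated with the circle of radius `r`
centered at `lam`: `(2πi)⁻¹ ∮_{|σ-λ|=r} (σ - T)⁻¹ dσ`. -/
noncomputable def rieszProjection {H : Type*} [NormedAddCommGroup H] [NormedSpace ℂ H]
    (T : H →L[ℂ] H) (lam : ℂ) (r : ℝ) : H →L[ℂ] H :=
  (2 * (Real.pi : ℂ) * Complex.I)⁻¹ •
    ∮ σ in C(lam, r), Ring.inverse (algebraMap ℂ (H →L[ℂ] H) σ - T)

/-- `lam` belongs to the discrete spectrum of the bounded operator `T`: it is an isolated point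
of the spectrum and, for some `r > 0` isolating it, the associated Riesz projection has finite
rank. -/
def InDiscreteSpectrum {H : Type*} [NormedAddCommGroup H] [NormedSpace ℂ H]
    (T : H →L[ℂ] H) (lam : ℂ) : Prop :=
  lam ∈ spectrum ℂ T ∧ ∃ r : ℝ, 0 < r ∧
    spectrum ℂ T ∩ Metric.closedBall lam (2 * r) = {lam} ∧
    FiniteDimensional ℂ (LinearMap.range ((rieszProjection T lam r) : H →ₗ[ℂ] H))

/-- The essential spectrum of a bounded operator: the spectrum minus the discrete spectrum. -/
def essentialSpectrum {H : Type*} [NormedAddCommGroup H] [NormedSpace ℂ H]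
    (T : H →L[ℂ] H) : Set ℂ :=
  spectrum ℂ T \ {lam | InDiscreteSpectrum T lam}

lemma weyl_clm_circleIntegral {E F : Type*} [NormedAddCommGroup E] [NormedSpace ℂ E]
    [CompleteSpace E] [NormedAddCommGroup F] [NormedSpace ℂ F] [CompleteSpace F]
    (L : E →L[ℂ] F) {f : ℂ → E} {c : ℂ} {r : ℝ} (hr : 0 ≤ r)
    (hf : ContinuousOn f (Metric.sphere c r)) :
    L (∮ z in C(c, r), f z) = ∮ z in C(c, r), L (f z) := by
  have h := (hf.circleIntegrable hr).out
  simp only [circleIntegral]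
  rw [← ContinuousLinearMap.intervalIntegral_comp_comm L h]
  simp

lemma weyl_inverse_differentiableAt {H : Type*} [NormedAddCommGroup H] [NormedSpace ℂ H]
    [CompleteSpace H] (T : H →L[ℂ] H) {z : ℂ}
    (hz : IsUnit (algebraMap ℂ (H →L[ℂ] H) z - T)) :
    DifferentiableAt ℂ (fun z => Ring.inverse (algebraMap ℂ (H →L[ℂ] H) z - T)) z := by
  have h1 : DifferentiableAt ℂ (fun z : ℂ => algebraMap ℂ (H →L[ℂ] H) z - T) z := by
    simp only [Algebra.algebraMap_eq_smul_one]
    fun_prop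
  exact (differentiableAt_inverse hz).comp z h1

lemma weyl_riesz_parametrix {H : Type*} [NormedAddCommGroup H] [NormedSpace ℂ H]
    [CompleteSpace H] (T : H →L[ℂ] H) (lam : ℂ) (r : ℝ) (hr : 0 < r)
    (hs : ∀ z ∈ Metric.sphere lam r, z ∉ spectrum ℂ T) :
    ∃ S : H →L[ℂ] H, (algebraMap ℂ (H →L[ℂ] H) lam - T) * S = 1 - rieszProjection T lam r ∧
      S * (algebraMap ℂ (H →L[ℂ] H) lam - T) = 1 - rieszProjection T lam r := by
  set R : ℂ → (H →L[ℂ] H) := fun z => Ring.inverse (algebraMap ℂ (H →L[ℂ] H) z - T) with hR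
  have hu : ∀ z ∈ Metric.sphere lam r, IsUnit (algebraMap ℂ (H →L[ℂ] H) z - T) :=
    fun z hz => spectrum.notMem_iff.1 (hs z hz)
  have hRc : ContinuousOn R (Metric.sphere lam r) := fun z hz =>
    (weyl_inverse_differentiableAt T (hu z hz)).continuousAt.continuousWithinAt
  have hne : ∀ z ∈ Metric.sphere lam r, z - lam ≠ 0 := by
    intro z hz h
    rw [sub_eq_zero] at h
    subst h
    simp at hz
    exact hr.ne hz
  have hinv : ContinuousOn (fun z : ℂ => (z - lam)⁻¹) (Metric.sphere lam r) :=
    ContinuousOn.inv₀ (by fun_prop) hne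
  have hSc : ContinuousOn (fun z => (z - lam)⁻¹ • R z) (Metric.sphere lam r) := hinv.smul hRc
  have hpi : (2 * (Real.pi : ℂ) * Complex.I) ≠ 0 := by
    simp [Real.pi_ne_zero]
  have key : ∮ z in C(lam, r), ((z - lam)⁻¹ • (1 : H →L[ℂ] H) - R z) =
      (2 * (Real.pi : ℂ) * Complex.I) • (1 : H →L[ℂ] H) - ∮ z in C(lam, r), R z := by
    rw [circleIntegral.integral_sub, circleIntegral.integral_smul_const,
      circleIntegral.integral_sub_inv_of_mem_ball (Metric.mem_ball_self hr)]
    · exact (hinv.smul continuousOn_const).circleIntegrable hr.le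
    · exact hRc.circleIntegrable hr.le
  have fin : (2 * (Real.pi : ℂ) * Complex.I)⁻¹ • (∮ z in C(lam, r),
      ((z - lam)⁻¹ • (1 : H →L[ℂ] H) - R z)) = 1 - rieszProjection T lam r := by
    rw [key, smul_sub, smul_smul, inv_mul_cancel₀ hpi, one_smul]
    rfl
  have e : ∀ z : ℂ, (algebraMap ℂ (H →L[ℂ] H) lam - T) =
      (algebraMap ℂ (H →L[ℂ] H) z - T) - (z - lam) • 1 := by
    intro z
    simp only [Algebra.algebraMap_eq_smul_one, sub_smul]
    abel
  refine ⟨(2 * (Real.pi : ℂ) * Complex.I)⁻¹ • ∮ z in C(lam, r), (z - lam)⁻¹ • R z, ?_, ?_⟩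
  · rw [mul_smul_comm]
    have := weyl_clm_circleIntegral (ContinuousLinearMap.mul ℂ (H →L[ℂ] H)
      (algebraMap ℂ (H →L[ℂ] H) lam - T)) hr.le hSc
    rw [ContinuousLinearMap.mul_apply'] at this
    rw [this, ← fin]
    congr 1
    refine circleIntegral.integral_congr hr.le fun z hz => ?_
    simp only [ContinuousLinearMap.mul_apply']
    rw [mul_smul_comm, e z, sub_mul, Ring.mul_inverse_cancel _ (hu z hz), smul_mul_assoc, one_mul,
      smul_sub, smul_smul, inv_mul_cancel₀ (hne z hz), one_smul]
  · rw [smul_mul_assoc]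
    have := weyl_clm_circleIntegral ((ContinuousLinearMap.mul ℂ (H →L[ℂ] H)).flip
      (algebraMap ℂ (H →L[ℂ] H) lam - T)) hr.le hSc
    rw [ContinuousLinearMap.flip_apply, ContinuousLinearMap.mul_apply'] at this
    rw [this, ← fin]
    congr 1
    refine circleIntegral.integral_congr hr.le fun z hz => ?_
    simp only [ContinuousLinearMap.mul_apply', ContinuousLinearMap.flip_apply]
    rw [smul_mul_assoc, e z, mul_sub, Ring.inverse_mul_cancel _ (hu z hz), mul_smul_comm, mul_one,
      smul_sub, smul_smul, inv_mul_cancel₀ (hne z hz), one_smul]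

/-- An operator invertible modulo a commuting finite rank operator
becomes invertible after adding a compact operator. -/
lemma weyl_exists_compact {H : Type*} [NormedAddCommGroup H] [InnerProductSpace ℂ H]
    [CompleteSpace H] (T S P : H →L[ℂ] H) (h1 : T * S = 1 - P) (h2 : S * T = 1 - P)
    (hP : FiniteDimensional ℂ (LinearMap.range (P : H →ₗ[ℂ] H))) :
    ∃ K : H →L[ℂ] H, IsCompactOperator (⇑K) ∧ IsUnit (T + K) := by
  set V := LinearMap.range (P : H →ₗ[ℂ] H) with hV
  have h1' : ∀ x, T (S x) = x - P x := fun x => by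
    simpa using congrArg (fun f : H →L[ℂ] H => f x) h1
  have h2' : ∀ x, S (T x) = x - P x := fun x => by
    simpa using congrArg (fun f : H →L[ℂ] H => f x) h2
  have hPV : ∀ x, P x ∈ V := fun x => ⟨x, rfl⟩
  have hTP : ∀ x, T (P x) = P (T x) := fun x => by
    have a := h1' (T x)
    rw [h2', map_sub] at a
    simpa using a
  have hSP : ∀ x, S (P x) = P (S x) := fun x => by
    have a := h2' (S x)
    rw [h1', map_sub] at a
    simpa using a
  have hTV : ∀ x ∈ V, T x ∈ V := by
    rintro _ ⟨x, rfl⟩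
    exact ⟨T x, (hTP x).symm⟩
  have hSV : ∀ x ∈ V, S x ∈ V := by
    rintro _ ⟨x, rfl⟩
    exact ⟨S x, (hSP x).symm⟩
  let T0 : Module.End ℂ V := (T : H →ₗ[ℂ] H).restrict hTV
  obtain ⟨c, hc⟩ := (Module.End.finite_spectrum T0).infinite_compl.nonempty
  have hcu : IsUnit (T0 - algebraMap ℂ _ c) := by
    have := spectrum.notMem_iff.1 hc
    rw [← neg_sub]
    exact this.neg
  have hcb := (Module.End.isUnit_iff _).1 hcu
  refine ⟨-c • V.starProjection, ?_, ?_⟩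
  · refine IsCompactOperator.smul (f := ⇑V.starProjection) ?_ (-c)
    have hc1 : IsCompactOperator (⇑(V.subtypeL)) := isCompactOperator_of_locallyCompactSpace_rng _
    exact hc1.comp_clm V.orthogonalProjectionOnto
  · have hx0 : ∀ v : V, (T + -c • V.starProjection) v = ((T0 - algebraMap ℂ _ c) v : V) := by
      intro v
      have : V.starProjection (v : H) = v := Submodule.starProjection_eq_self_iff.2 v.2
      simp [this, T0, sub_eq_add_neg, Module.algebraMap_end_apply]
    have hpm : ∀ x, V.starProjection x ∈ V := fun x => Submodule.starProjection_apply_mem _ _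
    rw [ContinuousLinearMap.isUnit_iff_bijective]
    constructor
    · rw [injective_iff_map_eq_zero]
      intro x hx
      have hxT : T x = c • V.starProjection x := by
        have : T x + -c • V.starProjection x = 0 := hx
        rw [neg_smul, ← sub_eq_add_neg, sub_eq_zero] at this
        exact this
      have hxV : x ∈ V := by
        have := h2' x
        rw [hxT] at this
        have h3 : x = S (c • V.starProjection x) + P x := by rw [this]; abel
        rw [h3]
        exact V.add_mem (hSV _ (V.smul_mem _ (hpm x))) (hPV x)
      have := hx0 ⟨x, hxV⟩
      rw [hx] at this
      have h4 : (T0 - algebraMap ℂ _ c) ⟨x, hxV⟩ = 0 := Subtype.ext this.symm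
      have := (injective_iff_map_eq_zero _).1 hcb.1 _ h4
      exact congrArg Subtype.val this
    · intro y
      have hd : y - (T + -c • V.starProjection) (S y) ∈ V := by
        have : y - (T + -c • V.starProjection) (S y) = P y + c • V.starProjection (S y) := by
          simp [h1']
          abel
        rw [this]
        exact V.add_mem (hPV y) (V.smul_mem _ (hpm _))
      obtain ⟨v, hv⟩ := hcb.2 ⟨_, hd⟩
      refine ⟨S y + v, ?_⟩
      rw [map_add, hx0, hv]
      exact add_sub_cancel _ _

lemma weyl_A_side {H : Type*} [NormedAddCommGroup H] [InnerProductSpace ℂ H]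
    [CompleteSpace H] (A : H →L[ℂ] H) (lam : ℂ) (h : lam ∉ essentialSpectrum A) :
    ∃ K : H →L[ℂ] H, IsCompactOperator (⇑K) ∧
      IsUnit (algebraMap ℂ (H →L[ℂ] H) lam - A + K) := by
  by_cases hl : lam ∈ spectrum ℂ A
  · have hd : InDiscreteSpectrum A lam := by
      by_contra hn
      exact h ⟨hl, hn⟩
    obtain ⟨-, r, hr, hiso, hfin⟩ := hd
    obtain ⟨S, hS1, hS2⟩ := weyl_riesz_parametrix A lam r hr (by
      intro z hz hzs
      have hz' : z ∈ spectrum ℂ A ∩ Metric.closedBall lam (2 * r) := by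
        refine ⟨hzs, ?_⟩
        rw [Metric.mem_closedBall, Metric.mem_sphere.1 hz]
        linarith
      rw [hiso] at hz'
      rw [Set.mem_singleton_iff.1 hz'] at hz
      simp at hz
      exact hr.ne hz)
    exact weyl_exists_compact _ S _ hS1 hS2 hfin
  · exact ⟨0, isCompactOperator_zero, by simpa using spectrum.notMem_iff.1 hl⟩

lemma weyl_finite_approx {H : Type*} [NormedAddCommGroup H] [InnerProductSpace ℂ H]
    [CompleteSpace H] (K : H →L[ℂ] H) (hK : IsCompactOperator (⇑K)) (ε : ℝ) (hε : 0 < ε) :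
    ∃ (n : ℕ) (C : H →L[ℂ] (Fin n → ℂ)) (J : (Fin n → ℂ) →L[ℂ] H), ‖K - J ∘L C‖ ≤ ε := by
  obtain ⟨s, hs, hsub⟩ := IsCompactOperator.image_closedBall_subset_compact
    (f := (K : H →ₗ[ℂ] H)) hK 1
  obtain ⟨t, hts, htf, hcov⟩ := hs.finite_cover_balls hε
  set W := Submodule.span ℂ t with hW
  have : FiniteDimensional ℂ W := FiniteDimensional.span_of_finite ℂ htf
  let e := (Module.finBasis ℂ W).equivFunL
  refine ⟨_, (e : W →L[ℂ] (Fin (Module.finrank ℂ W) → ℂ)) ∘L W.orthogonalProjectionOnto ∘L K, W.subtypeL ∘L (e.symm : (Fin (Module.finrank ℂ W) → ℂ) →L[ℂ] W), ?_⟩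
  have he : (W.subtypeL ∘L (e.symm : (Fin (Module.finrank ℂ W) → ℂ) →L[ℂ] W)) ∘L
      ((e : W →L[ℂ] _) ∘L W.orthogonalProjectionOnto ∘L K) = W.starProjection ∘L K := by
    ext x
    simp
  rw [he]
  refine ContinuousLinearMap.opNorm_le_of_unit_norm (𝕜 := ℂ) hε.le ?_
  intro x hx
  have hmem : K x ∈ s := hsub ⟨x, by simp [hx], rfl⟩
  obtain ⟨y, hy, hxy⟩ := Set.mem_iUnion₂.1 (hcov hmem)
  have hyW : y ∈ W := Submodule.subset_span hy
  have : ‖K x - W.starProjection (K x)‖ ≤ ‖K x - y‖ := by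
    rw [Submodule.starProjection_minimal]
    exact ciInf_le ⟨0, by rintro _ ⟨_, rfl⟩; positivity⟩ (⟨y, hyW⟩ : W)
  refine this.trans ?_
  rw [← dist_eq_norm]
  exact (Metric.mem_ball.1 hxy).le

lemma weyl_finite_rank {H : Type*} [NormedAddCommGroup H] [InnerProductSpace ℂ H]
    [CompleteSpace H] (T K : H →L[ℂ] H) (hK : IsCompactOperator (⇑K)) (hu : IsUnit (T + K)) :
    ∃ (n : ℕ) (C : H →L[ℂ] (Fin n → ℂ)) (J : (Fin n → ℂ) →L[ℂ] H), IsUnit (T + J ∘L C) := by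
  obtain ⟨ε, hε, hb⟩ := Metric.isOpen_iff.1 (Units.isOpen (R := H →L[ℂ] H)) _ hu
  obtain ⟨n, C, J, h⟩ := weyl_finite_approx K hK (ε / 2) (by linarith)
  refine ⟨n, C, J, hb ?_⟩
  rw [Metric.mem_ball, dist_comm, dist_eq_norm, add_sub_add_left_eq_sub]
  linarith

lemma weyl_residue_rec {H : Type*} [NormedAddCommGroup H] [NormedSpace ℂ H]
    [CompleteSpace H] (G : H →L[ℂ] H) (n : ℕ) (J : (Fin n → ℂ) →L[ℂ] H) (lam : ℂ) (r : ℝ)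
    (hr : 0 < r)
    (hu : ∀ z ∈ Metric.closedBall lam r, IsUnit (algebraMap ℂ (H →L[ℂ] H) z - G)) (m : ℕ) :
    ∃ W : Submodule ℂ H, FiniteDimensional ℂ W ∧ ∀ g : ℂ → (Fin n → ℂ),
      ContinuousOn g (Metric.sphere lam r) →
      (∃ h : ℂ → (Fin n → ℂ), (∀ z ∈ Metric.closedBall lam r, DifferentiableAt ℂ h z) ∧
        ∀ z ∈ Metric.sphere lam r, (z - lam) ^ m • g z = h z) →
      (∮ z in C(lam, r), Ring.inverse (algebraMap ℂ (H →L[ℂ] H) z - G) (J (g z))) ∈ W := by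
  set R : ℂ → (H →L[ℂ] H) := fun z => Ring.inverse (algebraMap ℂ (H →L[ℂ] H) z - G) with hR
  have hRd : ∀ z ∈ Metric.closedBall lam r, DifferentiableAt ℂ R z :=
    fun z hz => weyl_inverse_differentiableAt G (hu z hz)
  have hsc : ∀ z ∈ Metric.sphere lam r, z ∈ Metric.closedBall lam r :=
    fun z hz => Metric.sphere_subset_closedBall hz
  induction m with
  | zero =>
    refine ⟨⊥, inferInstance, ?_⟩
    rintro g hg ⟨h, hh, hgh⟩
    have h0 : (∮ z in C(lam, r), R z (J (g z))) = ∮ z in C(lam, r), R z (J (h z)) := by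
      refine circleIntegral.integral_congr hr.le fun z hz => ?_
      have := hgh z hz
      simp only [pow_zero, one_smul] at this
      simp only [this]
    have hd : ∀ z ∈ Metric.closedBall lam r, DifferentiableAt ℂ (fun z => R z (J (h z))) z := by
      intro z hz
      exact (hRd z hz).clm_apply (J.differentiableAt.comp z (hh z hz))
    change (∮ z in C(lam, r), R z (J (g z))) ∈ _
    rw [h0, Submodule.mem_bot]
    exact Complex.circleIntegral_eq_zero_of_differentiable_on_off_countable hr.le
      Set.countable_empty (fun z hz => (hd z hz).continuousAt.continuousWithinAt)
      (fun z hz => hd z (Metric.ball_subset_closedBall hz.1))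
  | succ m ih =>
    obtain ⟨W, hW, hWg⟩ := ih
    refine ⟨(LinearMap.range (J : (Fin n → ℂ) →ₗ[ℂ] H) ⊔ W).map (R lam : H →ₗ[ℂ] H),
      inferInstance, ?_⟩
    rintro g hg ⟨h, hh, hgh⟩
    have hg2 : ContinuousOn (fun z => (z - lam) • g z) (Metric.sphere lam r) := by
      fun_prop
    have hI := hWg (fun z => (z - lam) • g z) hg2 ⟨h, hh, fun z hz => by
      rw [← hgh z hz, smul_smul, pow_succ]⟩
    have hl : lam ∈ Metric.closedBall lam r := Metric.mem_closedBall_self hr.le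
    have hRc : ContinuousOn R (Metric.sphere lam r) := fun z hz =>
      (hRd z (hsc z hz)).continuousAt.continuousWithinAt
    have hid : ∀ z ∈ Metric.sphere lam r, R z (J (g z)) =
        R lam (J (g z) - R z (J ((z - lam) • g z))) := by
      intro z hz
      have e : algebraMap ℂ (H →L[ℂ] H) z - G =
          (algebraMap ℂ (H →L[ℂ] H) lam - G) + (z - lam) • 1 := by
        simp only [Algebra.algebraMap_eq_smul_one, sub_smul]
        abel
      have e1 : (R lam) = R z + (z - lam) • (R lam * R z) := by
        have a1 : R lam * ((algebraMap ℂ (H →L[ℂ] H) z - G) * R z) = R lam := by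
          rw [Ring.mul_inverse_cancel _ (hu z (hsc z hz)), mul_one]
        rw [e, add_mul, mul_add, ← mul_assoc, Ring.inverse_mul_cancel _ (hu lam hl), one_mul,
          smul_mul_assoc, one_mul, mul_smul_comm] at a1
        exact a1.symm
      have e2 := congrArg (fun f : H →L[ℂ] H => f (J (g z))) e1
      simp only [add_apply, smul_apply] at e2
      rw [map_sub, e2, map_smul, map_smul, map_smul]
      simp
    have hc1 : ContinuousOn (fun z => J (g z)) (Metric.sphere lam r) :=
      J.continuous.comp_continuousOn hg
    have hc2 : ContinuousOn (fun z => R z (J ((z - lam) • g z))) (Metric.sphere lam r) :=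
      hRc.clm_apply (J.continuous.comp_continuousOn hg2)
    change (∮ z in C(lam, r), R z (J (g z))) ∈ _
    rw [circleIntegral.integral_congr hr.le hid,
      ← weyl_clm_circleIntegral (R lam) (f := fun z => J (g z) - R z (J ((z - lam) • g z)))
        hr.le (hc1.sub hc2),
      circleIntegral.integral_sub (hc1.circleIntegrable hr.le) (hc2.circleIntegrable hr.le)]
    refine Submodule.mem_map_of_mem (f := (R lam : H →ₗ[ℂ] H)) ?_
    refine Submodule.sub_mem _ (Submodule.mem_sup_left ?_) (Submodule.mem_sup_right hI)
    rw [← weyl_clm_circleIntegral J hr.le hg]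
    exact ⟨_, rfl⟩

/-- The Woodbury matrix. -/
def weylMatrix {H : Type*} [NormedAddCommGroup H] [NormedSpace ℂ H]
    (G : H →L[ℂ] H) {n : ℕ} (C : H →L[ℂ] (Fin n → ℂ)) (J : (Fin n → ℂ) →L[ℂ] H) (z : ℂ) :
    Matrix (Fin n) (Fin n) ℂ :=
  LinearMap.toMatrix' (LinearMap.id - ((C ∘L
    Ring.inverse (algebraMap ℂ (H →L[ℂ] H) z - G) ∘L J :
      (Fin n → ℂ) →L[ℂ] (Fin n → ℂ)) : (Fin n → ℂ) →ₗ[ℂ] (Fin n → ℂ)))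

lemma weylMatrix_mulVec {H : Type*} [NormedAddCommGroup H] [NormedSpace ℂ H]
    (G : H →L[ℂ] H) {n : ℕ} (C : H →L[ℂ] (Fin n → ℂ)) (J : (Fin n → ℂ) →L[ℂ] H) (z : ℂ)
    (v : Fin n → ℂ) : (weylMatrix G C J z).mulVec v =
      v - C (Ring.inverse (algebraMap ℂ (H →L[ℂ] H) z - G) (J v)) := by
  rw [weylMatrix, LinearMap.toMatrix'_mulVec]
  simp

lemma weylMatrix_differentiableAt {H : Type*} [NormedAddCommGroup H] [NormedSpace ℂ H]
    [CompleteSpace H] (G : H →L[ℂ] H) {n : ℕ} (C : H →L[ℂ] (Fin n → ℂ))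
    (J : (Fin n → ℂ) →L[ℂ] H) (z : ℂ) (hz : IsUnit (algebraMap ℂ (H →L[ℂ] H) z - G))
    (i j : Fin n) : DifferentiableAt ℂ (fun z => weylMatrix G C J z i j) z := by
  have h1 := weyl_inverse_differentiableAt G hz
  have h2 : DifferentiableAt ℂ (fun z => C (Ring.inverse (algebraMap ℂ (H →L[ℂ] H) z - G)
      (J (Pi.single j 1)))) z :=
    C.differentiableAt.comp z (h1.clm_apply (differentiableAt_const _))
  have h3 := (differentiableAt_pi.1 h2) i
  have h4 : (fun z => weylMatrix G C J z i j) = fun z => (Pi.single j (1 : ℂ) : Fin n → ℂ) i -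
      C (Ring.inverse (algebraMap ℂ (H →L[ℂ] H) z - G) (J (Pi.single j 1))) i := by
    funext z
    simp [weylMatrix, LinearMap.toMatrix'_apply]
  rw [h4]
  exact h3.const_sub _

lemma weyl_det_differentiableAt {n : ℕ} (M : ℂ → Matrix (Fin n) (Fin n) ℂ) (z : ℂ)
    (h : ∀ i j, DifferentiableAt ℂ (fun z => M z i j) z) :
    DifferentiableAt ℂ (fun z => (M z).det) z := by
  simp only [Matrix.det_apply]
  refine DifferentiableAt.fun_sum fun s _ => ?_
  refine DifferentiableAt.const_smul ?_ _
  exact DifferentiableAt.fun_finsetProd fun i _ => h _ _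

lemma weyl_adjugate_differentiableAt {n : ℕ} (M : ℂ → Matrix (Fin n) (Fin n) ℂ) (z : ℂ)
    (h : ∀ i j, DifferentiableAt ℂ (fun z => M z i j) z) (i j : Fin n) :
    DifferentiableAt ℂ (fun z => (M z).adjugate i j) z := by
  simp only [Matrix.adjugate_apply]
  refine weyl_det_differentiableAt _ z fun k l => ?_
  by_cases hk : k = j
  · subst hk
    simp
  · simpa [Matrix.updateRow_apply, hk] using h k l

lemma weyl_det_iff {H : Type*} [NormedAddCommGroup H] [NormedSpace ℂ H]
    [CompleteSpace H] (B : H →L[ℂ] H) {n : ℕ} (C : H →L[ℂ] (Fin n → ℂ))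
    (J : (Fin n → ℂ) →L[ℂ] H) (z : ℂ)
    (hz : IsUnit (algebraMap ℂ (H →L[ℂ] H) z - (B - J ∘L C))) :
    (weylMatrix (B - J ∘L C) C J z).det ≠ 0 ↔ z ∉ spectrum ℂ B := by
  rw [spectrum.notMem_iff, ContinuousLinearMap.isUnit_iff_bijective]
  have hm := weylMatrix_mulVec (B - J ∘L C) C J z
  set M := weylMatrix (B - J ∘L C) C J z
  set L := algebraMap ℂ (H →L[ℂ] H) z - (B - J ∘L C) with hL
  have hLR : ∀ x, L (Ring.inverse L x) = x := fun x =>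
    congrArg (fun f : H →L[ℂ] H => f x) (Ring.mul_inverse_cancel _ hz)
  have hRL : ∀ x, Ring.inverse L (L x) = x := fun x =>
    congrArg (fun f : H →L[ℂ] H => f x) (Ring.inverse_mul_cancel _ hz)
  set T := algebraMap ℂ (H →L[ℂ] H) z - B with hT
  have hTL : ∀ x, T x = L x - J (C x) := by
    intro x
    simp [hT, hL]
    abel
  constructor
  · intro hd
    constructor
    · rw [injective_iff_map_eq_zero]
      intro x hx
      rw [hTL, sub_eq_zero] at hx
      have h1 : M.mulVec (C x) = 0 := by
        rw [hm, ← hx, hRL, sub_self]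
      have h2 : C x = 0 := by
        by_contra hne
        exact hd (Matrix.exists_mulVec_eq_zero_iff.1 ⟨_, hne, h1⟩)
      rw [← hRL x, hx, h2]
      simp
    · intro y
      set v := M⁻¹.mulVec (C (Ring.inverse L y)) with hv
      have hMv : M.mulVec v = C (Ring.inverse L y) := by
        rw [hv, Matrix.mulVec_mulVec, Matrix.mul_nonsing_inv _ (isUnit_iff_ne_zero.2 hd),
          Matrix.one_mulVec]
      rw [hm] at hMv
      refine ⟨Ring.inverse L (y + J v), ?_⟩
      have hC : C (Ring.inverse L (y + J v)) = v := by
        rw [map_add, map_add, ← hMv]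
        abel
      rw [hTL, hLR, hC]
      abel
  · intro hb hd
    obtain ⟨v, hv, hMv⟩ := Matrix.exists_mulVec_eq_zero_iff.2 hd
    rw [hm, sub_eq_zero] at hMv
    have h1 : T (Ring.inverse L (J v)) = 0 := by
      rw [hTL, hLR, ← hMv, sub_self]
    have h2 := (injective_iff_map_eq_zero _).1 hb.1 _ h1
    rw [h2, map_zero] at hMv
    exact hv hMv

lemma weyl_det_analyticAt {H : Type*} [NormedAddCommGroup H] [NormedSpace ℂ H]
    [CompleteSpace H] (G : H →L[ℂ] H) {n : ℕ} (C : H →L[ℂ] (Fin n → ℂ))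
    (J : (Fin n → ℂ) →L[ℂ] H) (lam : ℂ) 
    (hz : ∀ᶠ z in nhds lam, IsUnit (algebraMap ℂ (H →L[ℂ] H) z - G)) :
    AnalyticAt ℂ (fun z => (weylMatrix G C J z).det) lam := by
  rw [Complex.analyticAt_iff_eventually_differentiableAt]
  filter_upwards [hz] with z hz
  exact weyl_det_differentiableAt _ _ fun i j => weylMatrix_differentiableAt G C J z hz i j

lemma weyl_unit_eventually {H : Type*} [NormedAddCommGroup H] [NormedSpace ℂ H]
    [CompleteSpace H] (G : H →L[ℂ] H) (lam : ℂ)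
    (hu : IsUnit (algebraMap ℂ (H →L[ℂ] H) lam - G)) :
    ∀ᶠ z in nhds lam, IsUnit (algebraMap ℂ (H →L[ℂ] H) z - G) :=
  (spectrum.isOpen_resolventSet (𝕜 := ℂ) G).mem_nhds hu

lemma weyl_dichotomy {H : Type*} [NormedAddCommGroup H] [NormedSpace ℂ H]
    [CompleteSpace H] (B : H →L[ℂ] H) {n : ℕ} (C : H →L[ℂ] (Fin n → ℂ))
    (J : (Fin n → ℂ) →L[ℂ] H) (lam : ℂ)
    (hu : IsUnit (algebraMap ℂ (H →L[ℂ] H) lam - (B - J ∘L C))) :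
    (∀ᶠ z in nhdsWithin lam {lam}ᶜ, z ∉ spectrum ℂ B) ∨
      ∀ᶠ z in nhds lam, z ∈ spectrum ℂ B := by
  have hev := weyl_unit_eventually _ lam hu
  rcases (weyl_det_analyticAt _ C J lam hev).eventually_eq_zero_or_eventually_ne_zero with h | h
  · right
    filter_upwards [h, hev] with z h1 h2
    by_contra h3
    exact (weyl_det_iff B C J z h2).2 h3 h1
  · left
    filter_upwards [h, hev.filter_mono nhdsWithin_le_nhds] with z h1 h2
    exact (weyl_det_iff B C J z h2).1 h1

lemma weyl_discrete {H : Type*} [NormedAddCommGroup H] [NormedSpace ℂ H]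
    [CompleteSpace H] (B : H →L[ℂ] H) {n : ℕ} (C : H →L[ℂ] (Fin n → ℂ))
    (J : (Fin n → ℂ) →L[ℂ] H) (lam : ℂ)
    (hu : IsUnit (algebraMap ℂ (H →L[ℂ] H) lam - (B - J ∘L C)))
    (hiso : ∀ᶠ z in nhdsWithin lam {lam}ᶜ, z ∉ spectrum ℂ B) (hl : lam ∈ spectrum ℂ B) :
    InDiscreteSpectrum B lam := by
  have hev := weyl_unit_eventually _ lam hu
  have hm := weylMatrix_mulVec (B - J ∘L C) C J
  have hMd := weylMatrix_differentiableAt (B - J ∘L C) C J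
  have hdi := weyl_det_iff B C J
  have han := weyl_det_analyticAt _ C J lam hev
  set G := B - J ∘L C with hG
  set M := weylMatrix G C J with hM
  have hnz : ¬ ∀ᶠ z in nhds lam, (M z).det = 0 := by
    intro h
    have : ∀ᶠ z in nhdsWithin lam {lam}ᶜ, False := by
      filter_upwards [hiso, (h.and hev).filter_mono nhdsWithin_le_nhds] with z h1 h2
      exact (hdi z h2.2).2 h1 h2.1
    exact this.exists.elim fun _ h => h
  obtain ⟨m, q, hq, hq0, hqe⟩ := han.exists_eventuallyEq_pow_smul_nonzero_iff.2 hnz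
  have hqd := Complex.analyticAt_iff_eventually_differentiableAt.1 hq
  have hqn := hq.continuousAt.eventually_ne hq0
  have hiso' := eventually_nhdsWithin_iff.1 hiso
  obtain ⟨ρ, hρ, hball⟩ := Metric.nhds_basis_closedBall.eventually_iff.1
    (hev.and (hqe.and (hqd.and (hqn.and hiso'))))
  set r := ρ / 2 with hrdef
  have hr : 0 < r := by positivity
  have hsub : ∀ z ∈ Metric.closedBall lam r, z ∈ Metric.closedBall lam ρ := fun z hz =>
    Metric.closedBall_subset_closedBall (by linarith) hz
  have hsc : ∀ z ∈ Metric.sphere lam r, z ∈ Metric.closedBall lam r :=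
    fun z hz => Metric.sphere_subset_closedBall hz
  have hunit : ∀ z ∈ Metric.closedBall lam r, IsUnit (algebraMap ℂ (H →L[ℂ] H) z - G) :=
    fun z hz => (hball (hsub z hz)).1
  refine ⟨hl, r, hr, ?_, ?_⟩
  · have : 2 * r = ρ := by rw [hrdef]; ring
    rw [this]
    apply Set.eq_singleton_iff_unique_mem.2
    refine ⟨⟨hl, Metric.mem_closedBall_self hρ.le⟩, fun z hz => ?_⟩
    by_contra hne
    exact (hball hz.2).2.2.2.2 hne hz.1
  obtain ⟨W, hW, hWg⟩ := weyl_residue_rec G n J lam r hr hunit m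
  have hBu : ∀ z ∈ Metric.sphere lam r, IsUnit (algebraMap ℂ (H →L[ℂ] H) z - B) := by
    intro z hz
    refine spectrum.notMem_iff.1 ((hball (hsub z (hsc z hz))).2.2.2.2 ?_)
    rintro rfl
    simp at hz
    exact hr.ne hz
  set R : ℂ → (H →L[ℂ] H) := fun z => Ring.inverse (algebraMap ℂ (H →L[ℂ] H) z - B) with hR
  set Q : ℂ → (H →L[ℂ] H) := fun z => Ring.inverse (algebraMap ℂ (H →L[ℂ] H) z - G) with hQ
  have hRc : ContinuousOn R (Metric.sphere lam r) := fun z hz =>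
    (weyl_inverse_differentiableAt B (hBu z hz)).continuousAt.continuousWithinAt
  have hQd : ∀ z ∈ Metric.closedBall lam r, DifferentiableAt ℂ Q z :=
    fun z hz => weyl_inverse_differentiableAt G (hunit z hz)
  have hQc : ContinuousOn Q (Metric.sphere lam r) := fun z hz =>
    (hQd z (hsc z hz)).continuousAt.continuousWithinAt
  suffices hle : LinearMap.range ((rieszProjection B lam r) : H →ₗ[ℂ] H) ≤ W from
    Submodule.finiteDimensional_of_le hle
  rintro _ ⟨x, rfl⟩
  have hRx : ContinuousOn (fun z => R z x) (Metric.sphere lam r) :=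
    hRc.clm_apply continuousOn_const
  have hCR : ContinuousOn (fun z => C (R z x)) (Metric.sphere lam r) :=
    C.continuous.comp_continuousOn hRx
  have hPx : rieszProjection B lam r x =
      (2 * (Real.pi : ℂ) * Complex.I)⁻¹ • ∮ z in C(lam, r), R z x := by
    have := weyl_clm_circleIntegral (ContinuousLinearMap.apply ℂ H x) hr.le hRc
    simp only [ContinuousLinearMap.apply_apply] at this
    rw [← this]
    rfl
  have hsplit : ∀ z ∈ Metric.sphere lam r, R z x = Q z x + Q z (J (C (R z x))) := by
    intro z hz
    have h1 : (algebraMap ℂ (H →L[ℂ] H) z - B) (R z x) = x :=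
      congrArg (fun f : H →L[ℂ] H => f x) (Ring.mul_inverse_cancel _ (hBu z hz))
    have h2 : Q z ((algebraMap ℂ (H →L[ℂ] H) z - G) (R z x)) = R z x :=
      congrArg (fun f : H →L[ℂ] H => f (R z x)) (Ring.inverse_mul_cancel _ (hunit z (hsc z hz)))
    have h3 : (algebraMap ℂ (H →L[ℂ] H) z - G) (R z x) = x + J (C (R z x)) := by
      have h4 : (algebraMap ℂ (H →L[ℂ] H) z - G) (R z x) =
          (algebraMap ℂ (H →L[ℂ] H) z - B) (R z x) + J (C (R z x)) := by
        simp only [hG, sub_apply, ContinuousLinearMap.comp_apply]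
        abel
      rw [h4, h1]
    rw [h3, map_add] at h2
    exact h2.symm
  have hc1 : ContinuousOn (fun z => Q z x) (Metric.sphere lam r) :=
    hQc.clm_apply continuousOn_const
  have hc2 : ContinuousOn (fun z => Q z (J (C (R z x)))) (Metric.sphere lam r) :=
    hQc.clm_apply (J.continuous.comp_continuousOn hCR)
  have hQx : ∀ z ∈ Metric.closedBall lam r, DifferentiableAt ℂ (fun z => Q z x) z :=
    fun z hz => (hQd z hz).clm_apply (differentiableAt_const _)
  have hzero : (∮ z in C(lam, r), Q z x) = 0 :=
    Complex.circleIntegral_eq_zero_of_differentiable_on_off_countable hr.le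
      Set.countable_empty (fun z hz => (hQx z hz).continuousAt.continuousWithinAt)
      (fun z hz => hQx z (Metric.ball_subset_closedBall hz.1))
  change rieszProjection B lam r x ∈ W
  rw [hPx, circleIntegral.integral_congr hr.le hsplit,
    circleIntegral.integral_add (hc1.circleIntegrable hr.le) (hc2.circleIntegrable hr.le),
    hzero, zero_add]
  refine W.smul_mem _ (hWg _ hCR ⟨fun z => (q z)⁻¹ • (M z).adjugate.mulVec (C (Q z x)), ?_, ?_⟩)
  · intro z hz
    obtain ⟨_, _, hqd, hqn, _⟩ := hball (hsub z hz)
    refine (hqd.inv hqn).smul ?_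
    rw [differentiableAt_pi]
    intro i
    simp only [Matrix.mulVec, dotProduct]
    refine DifferentiableAt.fun_sum fun j _ => ?_
    refine (weyl_adjugate_differentiableAt M z (hMd z (hunit z hz)) i j).mul ?_
    exact differentiableAt_pi.1 (C.differentiableAt.comp z (hQx z hz)) j
  · intro z hz
    obtain ⟨_, hqe, hqd, hqn, _⟩ := hball (hsub z (hsc z hz))
    have h1 : C (Q z x) = (M z).mulVec (C (R z x)) := by
      rw [hm]
      conv_rhs => enter [1]; rw [hsplit z hz]
      rw [map_add]
      exact (add_sub_cancel_right _ _).symm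
    simp only
    rw [h1, Matrix.mulVec_mulVec, Matrix.adjugate_mul, Matrix.smul_mulVec, Matrix.one_mulVec,
      hqe, smul_smul, smul_eq_mul]
    congr 1
    field_simp

/-- **Weyl's essential spectrum theorem under relatively compact perturbation
(bounded-operator case).** -/
theorem weyl_essential_spectrum
    {H : Type*} [NormedAddCommGroup H] [InnerProductSpace ℂ H] [CompleteSpace H]
    (A B : H →L[ℂ] H) (hAB : IsCompactOperator (⇑(B - A)))
    (U : Set ℂ)
    (hU : ∃ z ∈ (essentialSpectrum A)ᶜ, U = connectedComponentIn (essentialSpectrum A)ᶜ z)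
    (hpt : ∃ z₀ ∈ U, z₀ ∉ spectrum ℂ A ∧ z₀ ∉ spectrum ℂ B) :
    U ∩ essentialSpectrum B = ∅ := by
  have hloc : ∀ lam ∈ U, ∃ (n : ℕ) (C : H →L[ℂ] (Fin n → ℂ)) (J : (Fin n → ℂ) →L[ℂ] H),
      IsUnit (algebraMap ℂ (H →L[ℂ] H) lam - (B - J ∘L C)) := by
    intro lam hlam
    obtain ⟨z, hz, rfl⟩ := hU
    have hl : lam ∉ essentialSpectrum A := connectedComponentIn_subset _ _ hlam
    obtain ⟨K, hK, hKu⟩ := weyl_A_side A lam hl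
    obtain ⟨n, C, J, h⟩ := weyl_finite_rank (algebraMap ℂ (H →L[ℂ] H) lam - B) ((B - A) + K)
      (hAB.add hK) (by
        convert hKu using 1
        abel)
    refine ⟨n, C, J, ?_⟩
    convert h using 1
    abel
  have hUc : IsPreconnected U := by
    obtain ⟨z, hz, rfl⟩ := hU
    exact isPreconnected_connectedComponentIn
  have hres : ∀ z, z ∉ spectrum ℂ B → ∀ᶠ w in nhds z, w ∉ spectrum ℂ B := fun z hz =>
    (spectrum.isClosed (𝕜 := ℂ) B).isOpen_compl.mem_nhds hz
  set O1 : Set ℂ := {z | ∀ᶠ w in nhdsWithin z {z}ᶜ, w ∉ spectrum ℂ B} with hO1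
  set O2 : Set ℂ := {z | ∀ᶠ w in nhds z, w ∈ spectrum ℂ B} with hO2
  have hO1o : IsOpen O1 := by
    rw [isOpen_iff_mem_nhds]
    intro z hz
    have hz' := eventually_nhdsWithin_iff.1 hz
    filter_upwards [hz'] with w hw
    by_cases hwz : w = z
    · rw [hwz]
      exact hz
    · exact (hres w (hw hwz)).filter_mono nhdsWithin_le_nhds
  have hO2o : IsOpen O2 := by
    rw [isOpen_iff_mem_nhds]
    intro z hz
    exact Filter.Eventually.eventually_nhds hz
  have hdisj : Disjoint O1 O2 := by
    rw [Set.disjoint_left]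
    intro z h1 h2
    have h1' : ∀ᶠ w in nhdsWithin z {z}ᶜ, w ∉ spectrum ℂ B := h1
    have h2' : ∀ᶠ w in nhdsWithin z {z}ᶜ, w ∈ spectrum ℂ B :=
      Filter.Eventually.filter_mono nhdsWithin_le_nhds h2
    obtain ⟨w, hw1, hw2⟩ := (h1'.and h2').exists
    exact hw1 hw2
  have hcov : U ⊆ O1 ∪ O2 := by
    intro z hz
    obtain ⟨n, C, J, h⟩ := hloc z hz
    exact weyl_dichotomy B C J z h
  obtain ⟨z₀, hz₀U, -, hz₀B⟩ := hpt
  have hsub : U ⊆ O1 := IsPreconnected.subset_left_of_subset_union hO1o hO2o hdisj hcov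
    ⟨z₀, hz₀U, (hres z₀ hz₀B).filter_mono nhdsWithin_le_nhds⟩ hUc
  rw [Set.eq_empty_iff_forall_notMem]
  rintro z ⟨hzU, hzs, hzd⟩
  obtain ⟨n, C, J, h⟩ := hloc z hzU
  exact hzd (weyl_discrete B C J z h (hsub hzU) hzs)

end
end
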